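/- For every ν ∈ [-1/2, 1), the supremum of F_ν(θ₁, θ₂, θ₃) over all triples of positive reals (θ₁, θ₂, θ₃) with θᵢ ≠ θⱼ for some i, j equals the supremum of F_ν(θ₁, θ₂, θ₂) over all positive reals θ₁ > θ₂. -/

import Mathlib

/-- The functional `F_ν` of the ES-BGK entropy comparison, expressed in terms of the
eigenvalues `θ₁, θ₂, θ₃` of the stress tensor. -/
noncomputable def Fnu (ν θ₁ θ₂ θ₃ : ℝ) : ℝ :=
  (3 * Real.log ((θ₁+θ₂+θ₃)/3)
    - Real.log (((1-ν) * ((θ₁+θ₂+θ₃)/3) + ν*θ₁) * ((1-ν) * ((θ₁+θ₂+θ₃)/3) + ν*θ₂)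
        * ((1-ν) * ((θ₁+θ₂+θ₃)/3) + ν*θ₃)))
  / (3 * Real.log ((θ₁+θ₂+θ₃)/3) - Real.log (θ₁*θ₂*θ₃))

/-- For `M ≤ 1` the quotient `log ((1 - a) M + a D) / log D` is monotone in `D` on `(0, 1)`. -/
theorem log_convexComb_div_log_le {a M D₁ D₂ : ℝ} (ha₀ : 0 ≤ a) (ha₁ : a ≤ 1) (hM₀ : 0 ≤ M)
    (hM₁ : M ≤ 1) (hD₁ : 0 < D₁) (hD : D₁ ≤ D₂) (hD₂ : D₂ < 1)
    (hN₁ : 0 < (1 - a) * M + a * D₁) :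
    Real.log ((1 - a) * M + a * D₁) / Real.log D₁
      ≤ Real.log ((1 - a) * M + a * D₂) / Real.log D₂ := by
  have hlog₁ : Real.log D₁ < 0 := Real.log_neg hD₁ (hD.trans_lt hD₂)
  have hlog₂ : Real.log D₂ < 0 := Real.log_neg (hD₁.trans_le hD) hD₂
  have hlog : Real.log D₁ ≤ Real.log D₂ := Real.log_le_log hD₁ hD
  set r : ℝ := Real.log D₂ / Real.log D₁ with hr
  have hr₀ : 0 ≤ r := (div_pos_of_neg_of_neg hlog₂ hlog₁).le
  have hr₁ : r ≤ 1 := (div_le_one_of_neg hlog₁).2 hlog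
  have hpow : D₁ ^ r = D₂ := by
    rw [Real.rpow_def_of_pos hD₁, hr, mul_div_cancel₀ _ hlog₁.ne,
      Real.exp_log (hD₁.trans_le hD)]
  have hconc := (Real.concaveOn_rpow hr₀ hr₁).2 (Set.mem_Ici.2 hM₀) (Set.mem_Ici.2 hD₁.le)
    (sub_nonneg.2 ha₁) ha₀ (sub_add_cancel 1 a)
  simp only [smul_eq_mul, hpow] at hconc
  have hMr : M ≤ M ^ r := Real.self_le_rpow_of_le_one hM₀ hM₁ hr₁
  have hle : (1 - a) * M + a * D₂ ≤ ((1 - a) * M + a * D₁) ^ r :=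
    le_trans (by gcongr) hconc
  have hN₂ : 0 < (1 - a) * M + a * D₂ := hN₁.trans_le (by gcongr)
  have hlogN := Real.log_le_log hN₂ hle
  rw [Real.log_rpow hN₁, hr] at hlogN
  rw [le_div_iff_of_neg hlog₂]
  calc _ ≤ _ := hlogN
    _ = _ := by ring

/-- Among triples with mean `m` and centred second moment `6 t²`, the entropy quotient is
monotone in the centred third moment `3 p`, up to the extreme value `p = 2 t³`. -/
theorem entropyQuotient_le {ν m t p : ℝ} (hν : ν < 1) (ht : 0 < t) (htm : t < m)
    (hp : p ≤ 2 * t ^ 3) (hD : 0 < m ^ 3 - 3 * t ^ 2 * m + p)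
    (hN : 0 < m ^ 3 - 3 * ν ^ 2 * t ^ 2 * m + ν ^ 3 * p)
    (hN' : 0 < m ^ 3 - 3 * ν ^ 2 * t ^ 2 * m + ν ^ 3 * (2 * t ^ 3)) :
    (3 * Real.log m - Real.log (m ^ 3 - 3 * ν ^ 2 * t ^ 2 * m + ν ^ 3 * p))
        / (3 * Real.log m - Real.log (m ^ 3 - 3 * t ^ 2 * m + p))
      ≤ (3 * Real.log m - Real.log (m ^ 3 - 3 * ν ^ 2 * t ^ 2 * m + ν ^ 3 * (2 * t ^ 3)))
        / (3 * Real.log m - Real.log (m ^ 3 - 3 * t ^ 2 * m + 2 * t ^ 3)) := by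
  have hm : 0 < m := ht.trans htm
  have hm3 : 0 < m ^ 3 := by positivity
  have hlogm : 3 * Real.log m = Real.log (m ^ 3) := by rw [Real.log_pow]; norm_num
  have hDD : m ^ 3 - 3 * t ^ 2 * m + p ≤ m ^ 3 - 3 * t ^ 2 * m + 2 * t ^ 3 := by linarith
  have hDm : m ^ 3 - 3 * t ^ 2 * m + 2 * t ^ 3 < m ^ 3 := by
    nlinarith [mul_pos (pow_pos ht 2) (sub_pos.2 htm), mul_pos (pow_pos ht 2) hm]
  rw [hlogm]
  rcases le_or_gt ν 0 with hν₀ | hν₀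
  · have hν3 : ν ^ 3 ≤ 0 := Odd.pow_nonpos (by decide) hν₀
    have hNm : m ^ 3 - 3 * ν ^ 2 * t ^ 2 * m + ν ^ 3 * (2 * t ^ 3) ≤ m ^ 3 := by
      have h₁ : ν ^ 3 * (2 * t ^ 3) ≤ 0 := mul_nonpos_of_nonpos_of_nonneg hν3 (by positivity)
      have h₂ : 0 ≤ 3 * ν ^ 2 * t ^ 2 * m := by positivity
      linarith
    apply div_le_div₀
    · exact sub_nonneg.2 (Real.log_le_log hN' hNm)
    · have h := mul_le_mul_of_nonpos_left hp hν3
      exact sub_le_sub_left (Real.log_le_log hN' (by linarith)) _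
    · exact sub_pos.2 (Real.log_lt_log (hD.trans_le hDD) hDm)
    · exact sub_le_sub_left (Real.log_le_log hD hDD) _
  · have hS : 0 < 1 + ν + ν ^ 2 := by positivity
    have hcomb : ∀ x : ℝ, (m ^ 3 - 3 * ν ^ 2 * t ^ 2 * m + ν ^ 3 * x) / m ^ 3
        = (1 - ν ^ 3) * (1 - 3 * t ^ 2 / m ^ 2 * (ν ^ 2 / (1 + ν + ν ^ 2)))
          + ν ^ 3 * ((m ^ 3 - 3 * t ^ 2 * m + x) / m ^ 3) := by
      intro x
      field_simp
      ring
    have hM : 3 * t ^ 2 / m ^ 2 * (ν ^ 2 / (1 + ν + ν ^ 2)) ≤ 1 := by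
      have h₁ : t ^ 2 / m ^ 2 ≤ 1 := (div_le_one (by positivity)).2 (by gcongr)
      have h₂ : 3 * (ν ^ 2 / (1 + ν + ν ^ 2)) ≤ 1 := by
        rw [← mul_div_assoc, div_le_one hS]
        nlinarith
      calc _ = t ^ 2 / m ^ 2 * (3 * (ν ^ 2 / (1 + ν + ν ^ 2))) := by ring
        _ ≤ 1 := mul_le_one₀ h₁ (by positivity) h₂
    have key := log_convexComb_div_log_le (a := ν ^ 3) (by positivity)
      (pow_le_one₀ hν₀.le hν.le) (sub_nonneg.2 hM) (sub_le_self _ (by positivity))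
      (div_pos hD hm3) (div_le_div_of_nonneg_right hDD hm3.le) ((div_lt_one hm3).2 hDm)
      (by rw [← hcomb]; exact div_pos hN hm3)
    rw [← hcomb, ← hcomb, Real.log_div hN.ne' hm3.ne', Real.log_div hD.ne' hm3.ne',
      Real.log_div hN'.ne' hm3.ne', Real.log_div (hD.trans_le hDD).ne' hm3.ne'] at key
    rw [← neg_sub _ (Real.log (m ^ 3)), ← neg_sub _ (Real.log (m ^ 3)), neg_div_neg_eq,
      ← neg_sub _ (Real.log (m ^ 3)), ← neg_sub _ (Real.log (m ^ 3)), neg_div_neg_eq]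
    exact key

/-- The factors appearing in the numerator of `Fnu` are positive. -/
theorem relaxedEigenvalue_pos {ν m θ : ℝ} (hν1 : -1/2 ≤ ν) (hν2 : ν < 1) (hθ : 0 < θ)
    (hm : θ < 3 * m) : 0 < (1 - ν) * m + ν * θ := by
  rcases le_or_gt 0 ν with h | h
  · have h₁ : 0 < (1 - ν) * m := mul_pos (sub_pos.2 hν2) (by linarith)
    have h₂ : 0 ≤ ν * θ := mul_nonneg h hθ.le
    linarith
  · nlinarith [mul_pos (neg_pos.2 h) (sub_pos.2 hm)]

/-- Every value of `Fnu` is dominated by a value at a triple with the two smaller entries equal. -/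
theorem exists_Fnu_le {ν x y z : ℝ} (hν1 : -1/2 ≤ ν) (hν2 : ν < 1) (hx : 0 < x) (hy : 0 < y)
    (hz : 0 < z) (hne : ¬(x = y ∧ y = z)) :
    ∃ θ₁ θ₂ : ℝ, 0 < θ₂ ∧ θ₂ < θ₁ ∧ Fnu ν x y z ≤ Fnu ν θ₁ θ₂ θ₂ := by
  obtain ⟨m, hm⟩ : ∃ m, m = (x + y + z) / 3 := ⟨_, rfl⟩
  have hzm : z = 3 * m - x - y := by linarith
  have hVpos : 0 < ((x - m) ^ 2 + (y - m) ^ 2 + (z - m) ^ 2) / 6 := by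
    by_contra! h
    have hx' : x - m = 0 := by nlinarith [sq_nonneg (x - m), sq_nonneg (y - m), sq_nonneg (z - m)]
    have hy' : y - m = 0 := by nlinarith [sq_nonneg (x - m), sq_nonneg (y - m), sq_nonneg (z - m)]
    exact hne ⟨by linarith, by linarith⟩
  obtain ⟨t, ht, htV⟩ : ∃ t : ℝ, 0 < t ∧
      t ^ 2 = ((x - m) ^ 2 + (y - m) ^ 2 + (z - m) ^ 2) / 6 :=
    ⟨_, Real.sqrt_pos.2 hVpos, Real.sq_sqrt hVpos.le⟩
  have hm₀ : 0 < m := by rw [hm]; positivity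
  have htm : t < m := by
    apply lt_of_pow_lt_pow_left₀ 2 hm₀.le
    have h₁ : 3 * (m ^ 2 - t ^ 2) = x * y + y * z + z * x := by
      rw [htV, hzm]; ring
    have h₂ : 0 < x * y + y * z + z * x := by positivity
    linarith
  have hp : (x - m) * (y - m) * (z - m) ≤ 2 * t ^ 3 := by
    refine le_of_abs_le (abs_le_of_sq_le_sq ?_ (by positivity))
    have h₁ : (2 * t ^ 3) ^ 2 = 4 * (t ^ 2) ^ 3 := by ring
    have h₂ : 27 * (4 * (t ^ 2) ^ 3 - ((x - m) * (y - m) * (z - m)) ^ 2)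
        = ((x - y) * (y - z) * (z - x)) ^ 2 := by
      rw [htV, hzm]; ring
    nlinarith [sq_nonneg ((x - y) * (y - z) * (z - x))]
  have hDen : x * y * z = m ^ 3 - 3 * t ^ 2 * m + (x - m) * (y - m) * (z - m) := by
    rw [htV, hzm]; ring
  have hNum : ((1 - ν) * m + ν * x) * ((1 - ν) * m + ν * y) * ((1 - ν) * m + ν * z)
      = m ^ 3 - 3 * ν ^ 2 * t ^ 2 * m + ν ^ 3 * ((x - m) * (y - m) * (z - m)) := by
    rw [mul_assoc 3 (ν ^ 2), mul_left_comm 3, htV, hzm]; ring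
  have hDen' : (m + 2 * t) * (m - t) * (m - t) = m ^ 3 - 3 * t ^ 2 * m + 2 * t ^ 3 := by ring
  have hNum' : ((1 - ν) * m + ν * (m + 2 * t)) * ((1 - ν) * m + ν * (m - t))
      * ((1 - ν) * m + ν * (m - t))
      = m ^ 3 - 3 * ν ^ 2 * t ^ 2 * m + ν ^ 3 * (2 * t ^ 3) := by ring
  have hm' : (m + 2 * t + (m - t) + (m - t)) / 3 = m := by ring
  refine ⟨m + 2 * t, m - t, by linarith, by linarith, ?_⟩
  unfold Fnu
  rw [hm', ← hm, hDen, hNum, hDen', hNum']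
  apply entropyQuotient_le hν2 ht htm hp
  · rw [← hDen]; positivity
  · rw [← hNum]
    exact mul_pos (mul_pos (relaxedEigenvalue_pos hν1 hν2 hx (by linarith))
      (relaxedEigenvalue_pos hν1 hν2 hy (by linarith)))
      (relaxedEigenvalue_pos hν1 hν2 hz (by linarith))
  · rw [← hNum']
    have h := relaxedEigenvalue_pos (m := m) hν1 hν2 (sub_pos.2 htm) (by linarith)
    exact mul_pos (mul_pos (relaxedEigenvalue_pos hν1 hν2 (by linarith) (by linarith)) h) h

theorem stmt_13 (ν : ℝ) (hν1 : -1/2 ≤ ν) (hν2 : ν < 1) :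
    sSup {y : ℝ | ∃ θ₁ θ₂ θ₃ : ℝ, 0 < θ₁ ∧ 0 < θ₂ ∧ 0 < θ₃ ∧
        ¬(θ₁ = θ₂ ∧ θ₂ = θ₃) ∧ y = Fnu ν θ₁ θ₂ θ₃}
      = sSup {y : ℝ | ∃ θ₁ θ₂ : ℝ, 0 < θ₂ ∧ θ₂ < θ₁ ∧ y = Fnu ν θ₁ θ₂ θ₂} := by
  apply csSup_eq_csSup_of_forall_exists_le
  · rintro _ ⟨x, y, z, hx, hy, hz, hne, rfl⟩
    obtain ⟨θ₁, θ₂, h₀, hlt, hle⟩ := exists_Fnu_le hν1 hν2 hx hy hz hne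
    exact ⟨_, ⟨θ₁, θ₂, h₀, hlt, rfl⟩, hle⟩
  · rintro _ ⟨θ₁, θ₂, h₀, hlt, rfl⟩
    exact ⟨_, ⟨θ₁, θ₂, θ₂, h₀.trans hlt, h₀, h₀, fun h => hlt.ne' h.1, rfl⟩, le_rfl⟩
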